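/- arXiv:2508.06478 — 9 statements merged into one kernel-verified Lean document; each statement's English description precedes it below -/
import Mathlib

section
/- Let G be a finite group and S = (S_1, …, S_k) a fully refined internal direct product decomposition of G, and fix i ∈ {1,…,k}. Then S_i appears (as the same subgroup of G) in every fully refined internal direct product decomposition of G if and only if for every j ≠ i, the orders |S_i/[S_i,S_i]| and |Z(S_j)| are coprime. -/
/-- An internal direct product decomposition of a group `G`: a finite family of normal
subgroups such that the multiplication map from the external direct product to `G` is a
group isomorphism. -/
def IsDirectProductDecomp {G : Type*} [Group G] {k : ℕ} (S : Fin k → Subgroup G) : Prop :=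
  (∀ i, (S i).Normal) ∧
    ∃ e : ((i : Fin k) → (S i)) ≃* G, ∀ f, e f = (List.ofFn fun i => ((f i : G))).prod

/-- A group is directly indecomposable if it is nontrivial and in every internal direct
product decomposition into two subgroups, one of the two subgroups is trivial. -/
def DirectlyIndecomposable (H : Type*) [Group H] : Prop :=
  Nontrivial H ∧ ∀ A B : Subgroup H, IsDirectProductDecomp ![A, B] → A = ⊥ ∨ B = ⊥

/-- A decomposition is fully refined if each factor is directly indecomposable. -/
def FullyRefined {G : Type*} [Group G] {k : ℕ} (S : Fin k → Subgroup G) : Prop :=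
  IsDirectProductDecomp S ∧ ∀ i, DirectlyIndecomposable (S i)

theorem prod_ofFn_single {M : Type*} [Monoid M] : ∀ {k : ℕ} (f : Fin k → M) (i : Fin k),
    (∀ j, j ≠ i → f j = 1) → (List.ofFn f).prod = f i := by
  intro k
  induction k with
  | zero => intro f i; exact i.elim0
  | succ n ih =>
    intro f i h
    rw [List.ofFn_succ, List.prod_cons]
    induction i using Fin.cases with
    | zero =>
      have h0 : (List.ofFn fun i : Fin n => f i.succ) = List.ofFn fun _ : Fin n => (1 : M) := by
        congr 1
        funext j
        exact h _ (Fin.succ_ne_zero j)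
      rw [h0]
      simp
    | succ i =>
      rw [h 0 (Fin.succ_ne_zero i).symm, one_mul]
      apply ih (fun i => f i.succ) i
      intro j hj
      exact h _ (fun h' => hj (Fin.succ_injective _ h'))

/-- The projections attached to a direct product decomposition. -/
theorem exists_proj {G : Type*} [Group G] {k : ℕ} {S : Fin k → Subgroup G}
    (hS : IsDirectProductDecomp S) :
    ∃ Q : Fin k → (G →* G), (∀ i x, Q i x ∈ S i) ∧ (∀ i, ∀ x ∈ S i, Q i x = x) ∧
      (∀ i j, j ≠ i → ∀ x ∈ S i, Q j x = 1) ∧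
      (∀ i g x, Q i (g * x * g⁻¹) = g * Q i x * g⁻¹) ∧
      (∀ x, (List.ofFn fun i => Q i x).prod = x) := by
  classical
  obtain ⟨hn, e, he⟩ := hS
  have hsingle : ∀ i (x : S i), e (Pi.mulSingle i x) = x := by
    intro i x
    rw [he, prod_ofFn_single _ i]
    · simp
    · intro j hj
      simp [Pi.mulSingle_eq_of_ne hj]
  have hsymm : ∀ i (x : S i), e.symm (x : G) = Pi.mulSingle i x := by
    intro i x
    rw [← hsingle i x, e.symm_apply_apply]
  let Q : Fin k → (G →* G) := fun i =>
    (S i).subtype.comp ((Pi.evalMonoidHom (fun i => S i) i).comp e.symm.toMonoidHom)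
  have hQ : ∀ i x, Q i x = (e.symm x i : G) := fun i x => rfl
  have h1 : ∀ i x, Q i x ∈ S i := fun i x => (e.symm x i).2
  have h2 : ∀ i, ∀ x ∈ S i, Q i x = x := by
    intro i x hx
    rw [hQ, hsymm i ⟨x, hx⟩]
    simp
  refine ⟨Q, h1, h2, ?_, ?_, ?_⟩
  · intro i j hj x hx
    rw [hQ, hsymm i ⟨x, hx⟩]
    simp [Pi.mulSingle_eq_of_ne hj]
  · intro i g x
    rw [← h2 i (g * Q i x * g⁻¹) ((hn i).conj_mem _ (h1 i x) g)]
    simp only [map_mul, map_inv]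
    rw [h2 i _ (h1 i x)]
  · intro x
    have := he (e.symm x)
    rw [e.apply_symm_apply] at this
    exact this.symm

theorem decomp_map {G H : Type*} [Group G] [Group H] (α : G ≃* H) {k : ℕ}
    {S : Fin k → Subgroup G} (hS : IsDirectProductDecomp S) :
    IsDirectProductDecomp (fun l => (S l).map (α : G →* H)) := by
  obtain ⟨hn, e, he⟩ := hS
  refine ⟨fun l => (hn l).map _ α.surjective, ?_⟩
  refine ⟨((MulEquiv.piCongrRight fun l => α.subgroupMap (S l)).symm.trans e).trans α, ?_⟩
  intro f
  obtain ⟨g, rfl⟩ := (MulEquiv.piCongrRight fun l => α.subgroupMap (S l)).surjective f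
  simp only [MulEquiv.trans_apply, MulEquiv.symm_apply_apply]
  rw [he, map_list_prod, List.map_ofFn]
  rfl

theorem indec_map {G H : Type*} [Group G] [Group H] (α : G ≃* H)
    (h : DirectlyIndecomposable G) : DirectlyIndecomposable H := by
  obtain ⟨hn, h⟩ := h
  refine ⟨α.symm.toEquiv.nontrivial, fun A B hAB => ?_⟩
  have := decomp_map α.symm hAB
  have h' := h (A.map (α.symm : H →* G)) (B.map (α.symm : H →* G)) (by
    convert this using 1
    funext l
    fin_cases l <;> rfl)
  have key : ∀ A : Subgroup H, A.map (α.symm : H →* G) = ⊥ → A = ⊥ := fun A hA =>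
    (Subgroup.map_eq_bot_iff_of_injective A α.symm.injective).1 hA
  exact h'.imp (key A) (key B)

theorem decomp_of_proj {H : Type*} [Group H] (p : H →* H) (h1 : ∀ x, p (p x) = p x)
    (h2 : ∀ g x, p (g * x * g⁻¹) = g * p x * g⁻¹) :
    IsDirectProductDecomp ![p.range, p.ker] := by
  have hn : p.range.Normal := ⟨by
    rintro _ ⟨x, rfl⟩ g
    exact ⟨g * x * g⁻¹, h2 g x⟩⟩
  have hcomm : ∀ x y, x ∈ p.range → y ∈ p.ker → x * y = y * x := by
    rintro _ y ⟨x, rfl⟩ hy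
    have := h2 y x
    rw [map_mul, map_mul, map_inv, (MonoidHom.mem_ker).1 hy] at this
    simp only [one_mul, inv_one, mul_one] at this
    exact eq_mul_inv_iff_mul_eq.1 this
  refine ⟨?_, ?_⟩
  · intro i
    fin_cases i
    · exact hn
    · exact p.normal_ker
  · let F : ((i : Fin 2) → (![p.range, p.ker] i)) →* H :=
      { toFun := fun f => ((f 0 : H)) * (f 1 : H)
        map_one' := by simp
        map_mul' := by
          intro f g
          have := hcomm (g 0) (f 1) (g 0).2 (f 1).2
          simp only [Pi.mul_apply, Subgroup.coe_mul]
          calc (f 0 : H) * g 0 * (f 1 * g 1) = f 0 * (g 0 * f 1) * g 1 := by group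
            _ = f 0 * (f 1 * g 0) * g 1 := by rw [this]
            _ = _ := by group }
    have hF : Function.Bijective F := by
      constructor
      · rw [injective_iff_map_eq_one]
        intro f hf
        have hf : (f 0 : H) * (f 1 : H) = 1 := hf
        obtain ⟨x, hx⟩ : (f 0 : H) ∈ p.range := (f 0).2
        have h1' : p (f 1 : H) = 1 := (f 1).2
        have h0 : (f 0 : H) = 1 := by
          have := congrArg p hf
          rw [map_mul, h1', mul_one, map_one, ← hx, h1, hx] at this
          exact this
        rw [h0, one_mul] at hf
        funext i
        fin_cases i
        · exact Subtype.ext h0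
        · exact Subtype.ext hf
      · intro x
        refine ⟨Fin.cons (⟨p x, x, rfl⟩ : p.range) (Fin.cons (⟨(p x)⁻¹ * x, by
          rw [MonoidHom.mem_ker, map_mul, map_inv, h1]; simp⟩ : p.ker) (fun i => i.elim0)), ?_⟩
        exact mul_inv_cancel_left (p x) x
    refine ⟨MulEquiv.ofBijective F hF, ?_⟩
    intro f
    simp [F, List.ofFn_succ]

theorem proj_trivial {H : Type*} [Group H] (hH : DirectlyIndecomposable H) (p : H →* H)
    (h1 : ∀ x, p (p x) = p x)
    (h2 : ∀ g x, p (g * x * g⁻¹) = g * p x * g⁻¹) : (∀ x, p x = 1) ∨ (∀ x, p x = x) := by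
  rcases hH.2 _ _ (decomp_of_proj p h1 h2) with h | h
  · left
    intro x
    have : p x ∈ p.range := ⟨x, rfl⟩
    rwa [h, Subgroup.mem_bot] at this
  · right
    intro x
    exact (MonoidHom.ker_eq_bot_iff p).1 h (h1 x)

/-- Same for a subgroup and an endomorphism of the ambient group. -/
theorem proj_trivial_sub {G : Type*} [Group G] (H : Subgroup G) (hH : DirectlyIndecomposable H)
    (p : G →* G) (h0 : ∀ x ∈ H, p x ∈ H) (h1 : ∀ x, p (p x) = p x)
    (h2 : ∀ g x, p (g * x * g⁻¹) = g * p x * g⁻¹) :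
    (∀ x ∈ H, p x = 1) ∨ (∀ x ∈ H, p x = x) := by
  let q : H →* H := (p.comp H.subtype).codRestrict H (fun x => h0 x x.2)
  have hq : ∀ x, (q x : G) = p x := fun _ => rfl
  rcases proj_trivial hH q (fun x => Subtype.ext (h1 x)) (fun g x => Subtype.ext (h2 g x)) with h | h
  · left
    intro x hx
    exact congrArg Subtype.val (h ⟨x, hx⟩)
  · right
    intro x hx
    exact congrArg Subtype.val (h ⟨x, hx⟩)

theorem exists_hom_zmod {A : Type*} [CommGroup A] [Finite A] {p : ℕ} [Fact p.Prime]
    (h : p ∣ Nat.card A) : ∃ f : A →* Multiplicative (ZMod p), ∃ a, f a = Multiplicative.ofAdd 1 := by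
  classical
  obtain ⟨ι, _, n, hn, ⟨e⟩⟩ := CommGroup.equiv_prod_multiplicative_zmod_of_finite A
  have hc : Nat.card A = ∏ i, n i := by
    rw [Nat.card_congr e.toEquiv, Nat.card_pi]
    refine Finset.prod_congr rfl fun i _ => ?_
    exact Nat.card_zmod (n i)
  rw [hc, (Nat.Prime.prime Fact.out).dvd_finsetProd_iff] at h
  obtain ⟨i, -, hi⟩ := h
  refine ⟨((ZMod.castHom hi (ZMod p)).toAddMonoidHom.toMultiplicative).comp
    ((Pi.evalMonoidHom _ i).comp e.toMonoidHom),
    e.symm (Pi.mulSingle i (Multiplicative.ofAdd 1)), ?_⟩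
  simp [ZMod.cast_one hi]

theorem exists_hom {A Z : Type*} [CommGroup A] [Finite A] [Group Z] [Finite Z]
    (h : ¬ Nat.Coprime (Nat.card A) (Nat.card Z)) : ∃ f : A →* Z, ∃ a, f a ≠ 1 := by
  obtain ⟨p, hp, h1, h2⟩ := Nat.Prime.not_coprime_iff_dvd.1 h
  have : Fact p.Prime := ⟨hp⟩
  obtain ⟨f, a, ha⟩ := exists_hom_zmod h1
  obtain ⟨z, hz⟩ := exists_prime_orderOf_dvd_card' p h2
  let g : ZMod p →+ Additive Z := ZMod.lift p ⟨zmultiplesHom _ (Additive.ofMul z), by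
    have : z ^ p = 1 := by rw [← hz]; exact pow_orderOf_eq_one z
    simp [← ofMul_pow, this]⟩
  refine ⟨(AddMonoidHom.toMultiplicativeLeft g).comp f, a, ?_⟩
  have : g 1 = Additive.ofMul z := by
    have := ZMod.lift_coe p ⟨zmultiplesHom _ (Additive.ofMul z), by
      have : z ^ p = 1 := by rw [← hz]; exact pow_orderOf_eq_one z
      simp [← ofMul_pow, this]⟩ 1
    simpa [g] using this
  intro h
  rw [MonoidHom.comp_apply, ha] at h
  have h : g 1 = 0 := h
  rw [this] at h
  have h : z = 1 := h
  rw [h, orderOf_one] at hz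
  exact hp.one_lt.ne hz

theorem hom_trivial {H Z : Type*} [Group H] [Finite H] [Group Z] [Finite Z]
    (hZ : ∀ a b : Z, a * b = b * a)
    (h : Nat.Coprime (Nat.card (Abelianization H)) (Nat.card Z)) (f : H →* Z) (x : H) :
    f x = 1 := by
  letI : CommGroup Z := { (inferInstance : Group Z) with mul_comm := hZ }
  rw [← Abelianization.lift_apply_of f x]
  have h1 : orderOf (Abelianization.lift f (Abelianization.of x)) ∣ Nat.card (Abelianization H) :=
    (orderOf_map_dvd _ _).trans (orderOf_dvd_natCard _)
  have h2 : orderOf (Abelianization.lift f (Abelianization.of x)) ∣ Nat.card Z :=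
    orderOf_dvd_natCard _
  exact orderOf_eq_one_iff.1 (Nat.eq_one_of_dvd_coprimes h h1 h2)

theorem stmt0 {G : Type*} [Group G] [Fintype G] {k : ℕ} (S : Fin k → Subgroup G)
    (hS : FullyRefined S) (i : Fin k) :
    (∀ (m : ℕ) (T : Fin m → Subgroup G), FullyRefined T → ∃ j, T j = S i) ↔
      (∀ j, j ≠ i →
        Nat.Coprime (Nat.card (Abelianization (S i))) (Nat.card (Subgroup.center (S j)))) := by
  obtain ⟨Q, q1, q2, q3, q4, q5⟩ := exists_proj hS.1
  have hcomm : ∀ a b, a ≠ b → ∀ x ∈ S a, ∀ y ∈ S b, x * y = y * x := by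
    intro a b hab x hx y hy
    have := q4 a y x
    rw [map_mul, map_mul, map_inv, q3 b a hab y hy, q2 a x hx] at this
    simp only [one_mul, inv_one, mul_one] at this
    exact eq_mul_inv_iff_mul_eq.1 this
  constructor
  · intro h j hj
    by_contra hco
    obtain ⟨f, a, ha⟩ := exists_hom hco
    obtain ⟨s, rfl⟩ := QuotientGroup.mk_surjective a
    -- the homomorphism into the center
    let φ : S i →* G := (S j).subtype.comp
      ((Subgroup.center (S j)).subtype.comp (f.comp Abelianization.of))
    have hφs : φ s ≠ 1 := by
      intro h1
      apply ha
      exact Subtype.ext (Subtype.ext h1)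
    have hφj : ∀ x, φ x ∈ S j := fun x => Subtype.prop _
    have hφc0 : ∀ x, ∀ y ∈ S j, y * φ x = φ x * y := by
      intro x y hy
      have := Subgroup.mem_center_iff.1 (f (Abelianization.of x)).2 ⟨y, hy⟩
      exact congrArg Subtype.val this
    have hφc : ∀ x g, g * φ x = φ x * g := by
      intro x g
      have h1 := q4 j g (φ x)
      rw [map_mul, map_mul, map_inv, q2 j _ (hφj x), hφc0 x _ (q1 j g)] at h1
      rw [mul_inv_cancel_right] at h1
      exact (eq_mul_inv_iff_mul_eq.1 h1).symm
    let ψ : G →* G := φ.comp ((Q i).codRestrict (S i) (q1 i))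
    have hψ : ∀ x (hx : x ∈ S i), ψ x = φ ⟨x, hx⟩ := by
      intro x hx
      show φ _ = φ _
      congr 1
      exact Subtype.ext (q2 i x hx)
    have hψj : ∀ x, ψ x ∈ S j := fun x => hφj _
    have hψ1 : ∀ l, l ≠ i → ∀ x ∈ S l, ψ x = 1 := by
      intro l hl x hx
      have : (Q i).codRestrict (S i) (q1 i) x = 1 := Subtype.ext (q3 l i hl.symm x hx)
      show φ _ = 1
      rw [this, map_one]
    have hψc : ∀ x g, g * ψ x = ψ x * g := fun x g => hφc _ g
    have hψψ : ∀ x, ψ (ψ x) = 1 := fun x => hψ1 j hj _ (hψj x)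
    let α : G ≃* G :=
      { toFun := fun g => g * ψ g
        invFun := fun g => g * (ψ g)⁻¹
        left_inv := by
          intro g
          simp [hψψ]
        right_inv := by
          intro g
          simp [hψψ]
        map_mul' := by
          intro x y
          rw [map_mul]
          calc x * y * (ψ x * ψ y) = x * (y * ψ x) * ψ y := by group
            _ = x * (ψ x * y) * ψ y := by rw [hψc x y]
            _ = _ := by group }
    have hα : ∀ g, α g = g * ψ g := fun _ => rfl
    obtain ⟨l, hl⟩ := h k (fun l => (S l).map (α : G →* G))
      ⟨decomp_map α hS.1, fun l => indec_map (α.subgroupMap (S l)) (hS.2 l)⟩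
    have hmem : ∀ x ∈ S l, x * ψ x ∈ S i := by
      intro x hx
      rw [← hl]
      exact ⟨x, hx, rfl⟩
    by_cases hli : l = i
    · subst hli
      have h1 := hmem s s.2
      rw [hψ _ s.2] at h1
      have h2 : φ s ∈ S l := (Subgroup.mul_mem_cancel_left _ s.2).1 h1
      have h3 := q3 l j hj _ h2
      rw [q2 j _ (hφj s)] at h3
      exact hφs h3
    · obtain ⟨x, hx⟩ := (nontrivial_iff_exists_ne (1 : S l)).1 (hS.2 l).1
      have h1 := hmem x x.2
      rw [hψ1 l hli _ x.2, mul_one] at h1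
      have h3 := q3 i l hli _ h1
      rw [q2 l _ x.2] at h3
      exact hx (Subtype.ext h3)
  · intro hco m T hT
    obtain ⟨P, p1, p2, p3, p4, p5⟩ := exists_proj hT.1
    have hPS : ∀ j, ∀ x ∈ S i, P j x ∈ S i := by
      intro j x hx
      have hz : ∀ l, l ≠ i → Q l (P j x) = 1 := by
        intro l hl
        let f0 : S i →* S l := (((Q l).comp (P j)).comp (S i).subtype).codRestrict (S l)
          (fun x => q1 l _)
        have hf0 : ∀ x, f0 x ∈ Subgroup.center (S l) := by
          intro x
          rw [Subgroup.mem_center_iff]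
          intro c
          apply Subtype.ext
          show (c : G) * Q l (P j x) = Q l (P j x) * c
          have hc : (c : G) * x * (c : G)⁻¹ = x := by
            rw [hcomm l i hl c c.2 x x.2, mul_inv_cancel_right]
          have h1 := p4 j c x
          rw [hc] at h1
          have h2 := q4 l c (P j x)
          rw [← h1] at h2
          exact (eq_mul_inv_iff_mul_eq.1 h2).symm
        have := hom_trivial
          (fun a b => Subtype.ext (Subgroup.mem_center_iff.1 b.2 a)) (hco l hl) (f0.codRestrict _ hf0) ⟨x, hx⟩
        exact congrArg Subtype.val (congrArg Subtype.val this)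
      rw [← q5 (P j x), prod_ofFn_single _ i hz]
      exact q1 i _
    have pidem : ∀ j x, P j (P j x) = P j x := fun j x => p2 j _ (p1 j x)
    obtain ⟨s, hs⟩ := (nontrivial_iff_exists_ne (1 : S i)).1 (hS.2 i).1
    have hex : ∃ j, P j s ≠ 1 := by
      by_contra hne
      push Not at hne
      apply hs
      apply Subtype.ext
      have := p5 s
      simp only [hne] at this
      simpa using this.symm
    obtain ⟨j, hjs⟩ := hex
    refine ⟨j, ?_⟩
    have hle : S i ≤ T j := by
      rcases proj_trivial_sub (S i) (hS.2 i) (P j) (hPS j) (pidem j) (p4 j) with h | h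
      · exact absurd (h s s.2) hjs
      · intro x hx
        rw [← h x hx]
        exact p1 j x
    apply le_antisymm _ hle
    rcases proj_trivial_sub (T j) (hT.2 j) (Q i) (fun x _ => hle (q1 i x))
      (fun x => q2 i _ (q1 i x)) (q4 i) with h | h
    · have := h s (hle s.2)
      rw [q2 i _ s.2] at this
      exact absurd (Subtype.ext this) hs
    · intro x hx
      rw [← h x hx]
      exact q1 i x
end

section
/- Let (G, ·) and (H, ∘) be finite groups, and suppose there exist bijections α, β, γ : G → H such that α(x) ∘ β(y) = γ(x · y) for all x, y ∈ G. Then G and H are isomorphic as groups. -/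
/-- If two finite groups are isotopic, they are isomorphic. -/
theorem stmt6 {G H : Type*} [Group G] [Fintype G] [Group H] [Fintype H]
    (α β γ : G → H) (hα : Function.Bijective α) (hβ : Function.Bijective β)
    (hγ : Function.Bijective γ) (h : ∀ x y : G, α x * β y = γ (x * y)) :
    Nonempty (G ≃* H) := by
  have h1 : ∀ x, α x = γ x * (β 1)⁻¹ := fun x => by
    rw [eq_mul_inv_iff_mul_eq, h, mul_one]
  have h2 : ∀ y, β y = (α 1)⁻¹ * γ y := fun y => by
    rw [eq_inv_mul_iff_mul_eq, h, one_mul]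
  have hm : ∀ x y, (α 1)⁻¹ * α (x * y) = ((α 1)⁻¹ * α x) * ((α 1)⁻¹ * α y) := fun x y => by
    rw [h1 (x * y), ← h x y, h2 y, h1 y]
    simp only [mul_assoc]
  let f : G →* H := MonoidHom.mk' (fun x => (α 1)⁻¹ * α x) hm
  exact ⟨MulEquiv.ofBijective f ((Group.mulLeft_bijective (α 1)⁻¹).comp hα)⟩
end

section
/- Let Q be a finite set with a quasigroup operation *. Suppose there exists a binary operation · on Q making (Q, ·) a group, together with bijections α, β, γ : Q → Q satisfying α(x) · β(y) = γ(x * y) for all x, y ∈ Q. Then the displacement group Dis(Q,*) acts regularly on Q, i.e., for all x, y ∈ Q there is a unique d ∈ Dis(Q,*) with d(x) = y. -/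
/-- The left translation by `a` in a left-cancellative-and-surjective binary structure,
as a permutation of `Q`. -/
noncomputable def leftTrans {Q : Type*} (op : Q → Q → Q) (hL : ∀ a, Function.Bijective (op a)) (a : Q) :
    Equiv.Perm Q :=
  Equiv.ofBijective (op a) (hL a)

/-- The displacement group `Dis(Q,*)`: the subgroup of the permutation group of `Q`
generated by `{ L_x ∘ L_y⁻¹ : x, y ∈ Q }`. -/
def dis {Q : Type*} (op : Q → Q → Q) (hL : ∀ a, Function.Bijective (op a)) :
    Subgroup (Equiv.Perm Q) :=
  Subgroup.closure { p | ∃ x y : Q, p = leftTrans op hL x * (leftTrans op hL y)⁻¹ }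

/-- If a finite quasigroup `(Q, *)` is isotopic to a group structure `(Q, ·)` on the same
set, then the displacement group `Dis(Q,*)` acts regularly on `Q`. -/
theorem stmt7 {Q : Type*} [Fintype Q] [Group Q] (op : Q → Q → Q)
    (hL : ∀ a, Function.Bijective (op a))
    (hR : ∀ a, Function.Bijective (fun x => op x a))
    (α β γ : Q → Q) (hα : Function.Bijective α) (hβ : Function.Bijective β)
    (hγ : Function.Bijective γ)
    (h : ∀ x y : Q, α x * β y = γ (op x y)) :
    ∀ x y : Q, ∃! d : Equiv.Perm Q, d ∈ dis op hL ∧ d x = y := by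
  have key : ∀ a b z : Q, γ ((leftTrans op hL a * (leftTrans op hL b)⁻¹) z)
      = α a * (α b)⁻¹ * γ z := by
    intro a b z
    obtain ⟨w, rfl⟩ := (leftTrans op hL b).surjective z
    have hw : (leftTrans op hL b)⁻¹ (leftTrans op hL b w) = w := Equiv.symm_apply_apply _ _
    rw [Equiv.Perm.mul_apply, hw]
    change γ (op a w) = α a * (α b)⁻¹ * γ (op b w)
    rw [← h, ← h]
    group
  have all : ∀ d ∈ dis op hL, ∃ g : Q, ∀ z, γ (d z) = g * γ z := by
    intro d hd
    unfold dis at hd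
    induction hd using Subgroup.closure_induction with
    | mem p hp =>
      obtain ⟨a, b, rfl⟩ := hp
      exact ⟨_, key a b⟩
    | one => exact ⟨1, fun z => by simp⟩
    | mul p q _ _ hp hq =>
      obtain ⟨g, hg⟩ := hp
      obtain ⟨k, hk⟩ := hq
      exact ⟨g * k, fun z => by rw [Equiv.Perm.mul_apply, hg, hk, mul_assoc]⟩
    | inv p _ hp =>
      obtain ⟨g, hg⟩ := hp
      refine ⟨g⁻¹, fun z => ?_⟩
      have := hg (p⁻¹ z)
      have hw : p (p⁻¹ z) = z := Equiv.apply_symm_apply _ _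
      rw [hw] at this
      rw [this, inv_mul_cancel_left]
  intro x y
  obtain ⟨a, ha⟩ := hα.2 (γ y * (γ x)⁻¹)
  obtain ⟨b, hb⟩ := hα.2 1
  have hd : (leftTrans op hL a * (leftTrans op hL b)⁻¹) x = y := by
    apply hγ.1
    rw [key, ha, hb]
    group
  have hm : leftTrans op hL a * (leftTrans op hL b)⁻¹ ∈ dis op hL :=
    Subgroup.subset_closure ⟨a, b, rfl⟩
  refine ⟨_, ⟨hm, hd⟩, ?_⟩
  rintro e ⟨he, hex⟩
  obtain ⟨g, hg⟩ := all e he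
  obtain ⟨k, hk⟩ := all _ hm
  have hgk : g = k := by
    apply mul_right_cancel (b := γ x)
    rw [← hg, ← hk, hex, hd]
  ext z
  apply hγ.1
  rw [hg, hk, hgk]
end

section
/- Let (Q, *) be a finite quasigroup such that the displacement group Dis(Q,*) acts regularly on Q, and fix e ∈ Q. Define a binary operation · on Q by x · y = (x * (e \ (y * e))) / e. Then (Q, ·) is a group; the map sending x ∈ Q to the permutation L_x ∘ L_e⁻¹ is a group isomorphism from (Q, ·) onto Dis(Q,*); and the triple of bijections (id, y ↦ e \ (y * e), z ↦ z * e) is an isotopism from (Q, ·) to (Q, *), i.e., (x · y) * e = x * (e \ (y * e)) for all x, y ∈ Q. -/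
/-- Left division: `ldiv op hL a b = a \ b` is the unique `x` with `op a x = b`. -/
noncomputable def ldiv {Q : Type*} (op : Q → Q → Q) (hL : ∀ a, Function.Bijective (op a))
    (a b : Q) : Q :=
  (Equiv.ofBijective (op a) (hL a)).symm b

/-- Right division: `rdiv op hR b a = b / a` is the unique `y` with `op y a = b`. -/
noncomputable def rdiv {Q : Type*} (op : Q → Q → Q)
    (hR : ∀ a, Function.Bijective (fun x => op x a)) (b a : Q) : Q :=
  (Equiv.ofBijective (fun x => op x a) (hR a)).symm b

/-- If the displacement group of a finite quasigroup `(Q,*)` acts regularly on `Q`,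
then for any fixed `e ∈ Q`, the operation `x · y = (x * (e \ (y * e))) / e` makes `Q`
a group, the map `x ↦ L_x ∘ L_e⁻¹` is a group isomorphism from `(Q, ·)` onto `Dis(Q,*)`,
and `(id, y ↦ e \ (y * e), z ↦ z * e)` is an isotopism from `(Q, ·)` to `(Q, *)`. -/
theorem stmt8 {Q : Type*} [Fintype Q] (op : Q → Q → Q)
    (hL : ∀ a, Function.Bijective (op a))
    (hR : ∀ a, Function.Bijective (fun x => op x a))
    (hreg : ∀ x y : Q, ∃! d : Equiv.Perm Q, d ∈ dis op hL ∧ d x = y) (e : Q) :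
    let m : Q → Q → Q := fun x y => rdiv op hR (op x (ldiv op hL e (op y e))) e
    let Φ : Q → Equiv.Perm Q := fun x => leftTrans op hL x * (leftTrans op hL e)⁻¹
    -- `(Q, ·)` is a group:
    (∃ one : Q, ∃ inv : Q → Q,
      (∀ x y z : Q, m (m x y) z = m x (m y z)) ∧
      (∀ x : Q, m one x = x) ∧ (∀ x : Q, m x one = x) ∧
      (∀ x : Q, m (inv x) x = one)) ∧
    -- `Φ` is a group isomorphism from `(Q, ·)` onto `Dis(Q,*)`:
    Function.Injective Φ ∧
    (∀ x : Q, Φ x ∈ dis op hL) ∧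
    (∀ d ∈ dis op hL, ∃ x : Q, Φ x = d) ∧
    (∀ x y : Q, Φ (m x y) = Φ x * Φ y) ∧
    -- the isotopism identity `γ(x · y) = α(x) * β(y)`:
    (∀ x y : Q, op (m x y) e = op x (ldiv op hL e (op y e))) := by
  intro m Φ
  have hm : ∀ x y : Q, op (m x y) e = op x (ldiv op hL e (op y e)) := fun x y =>
    (Equiv.ofBijective (fun x => op x e) (hR e)).apply_symm_apply _
  have hΦ : ∀ x z : Q, Φ x z = op x (ldiv op hL e z) := fun x z => rfl
  have hld : ∀ z : Q, ldiv op hL e (op e z) = z := fun z =>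
    (Equiv.ofBijective (op e) (hL e)).symm_apply_apply z
  have hΦe : ∀ x : Q, Φ x (op e e) = op x e := fun x => by rw [hΦ, hld]
  have hinj : Function.Injective Φ := fun x y h => by
    apply (hR e).1
    change op x e = op y e
    rw [← hΦe x, ← hΦe y, h]
  have hmem : ∀ x : Q, Φ x ∈ dis op hL := fun x => Subgroup.subset_closure ⟨x, e, rfl⟩
  have huniq : ∀ d₁ ∈ dis op hL, ∀ d₂ ∈ dis op hL, d₁ (op e e) = d₂ (op e e) → d₁ = d₂ :=
    fun d₁ h₁ d₂ h₂ h => (hreg (op e e) (d₂ (op e e))).unique ⟨h₁, h⟩ ⟨h₂, rfl⟩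
  have hsurj : ∀ d ∈ dis op hL, ∃ x : Q, Φ x = d := fun d hd => by
    obtain ⟨x, hx⟩ := (hR e).2 (d (op e e))
    exact ⟨x, huniq _ (hmem x) _ hd ((hΦe x).trans hx)⟩
  have hmul : ∀ x y : Q, Φ (m x y) = Φ x * Φ y := fun x y => by
    apply huniq _ (hmem _) _ (mul_mem (hmem x) (hmem y))
    change Φ (m x y) (op e e) = Φ x (Φ y (op e e))
    rw [hΦe, hΦe, hΦ, hm]
  have hone : Φ e = 1 := mul_inv_cancel _
  choose inv hinv using fun x => hsurj _ (inv_mem (hmem x))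
  refine ⟨⟨e, inv, fun x y z => hinj ?_, fun x => hinj ?_, fun x => hinj ?_, fun x => hinj ?_⟩,
    hinj, hmem, hsurj, hmul, hm⟩
  · simp only [hmul, mul_assoc]
  · rw [hmul, hone, one_mul]
  · rw [hmul, hone, mul_one]
  · rw [hmul, hone, hinv, inv_mul_cancel]
end

section
/- Let (Q, *) be a finite quasigroup and fix e ∈ Q. Then the displacement group Dis(Q,*) acts regularly on Q if and only if Dis(Q,*) equals, as a set of permutations, the set { L_x ∘ L_e⁻¹ : x ∈ Q }. -/
/-- For a finite quasigroup `(Q,*)` and any fixed `e ∈ Q`, the displacement group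
`Dis(Q,*)` acts regularly on `Q` if and only if, as a set of permutations, it equals
`{ L_x ∘ L_e⁻¹ : x ∈ Q }`. -/
theorem stmt10 {Q : Type*} [Fintype Q] (op : Q → Q → Q)
    (hL : ∀ a, Function.Bijective (op a))
    (hR : ∀ a, Function.Bijective (fun x => op x a)) (e : Q) :
    (∀ x y : Q, ∃! d : Equiv.Perm Q, d ∈ dis op hL ∧ d x = y) ↔
      (dis op hL : Set (Equiv.Perm Q)) =
        Set.range (fun x : Q => leftTrans op hL x * (leftTrans op hL e)⁻¹) := by
  have key : ∀ x y : Q, ∃ z, (leftTrans op hL z * (leftTrans op hL e)⁻¹) x = y := by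
    intro x y
    exact (hR ((leftTrans op hL e)⁻¹ x)).2 y
  have mem : ∀ z, leftTrans op hL z * (leftTrans op hL e)⁻¹ ∈ dis op hL :=
    fun z => Subgroup.subset_closure ⟨z, e, rfl⟩
  constructor
  · intro h
    ext d
    constructor
    · intro hd
      obtain ⟨z, hz⟩ := key e (d e)
      exact ⟨z, (h e (d e)).unique ⟨mem z, hz⟩ ⟨hd, rfl⟩⟩
    · rintro ⟨z, rfl⟩
      exact mem z
  · intro h x y
    obtain ⟨z, hz⟩ := key x y
    refine ⟨_, ⟨mem z, hz⟩, ?_⟩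
    rintro d ⟨hd, hdx⟩
    have hd2 : d ∈ (dis op hL : Set (Equiv.Perm Q)) := hd
    rw [h] at hd2
    obtain ⟨w, rfl⟩ := hd2
    have hwz : w = z := (hR ((leftTrans op hL e)⁻¹ x)).1 (hdx.trans hz.symm)
    rw [hwz]
end

section
/- Let (Q, *) be a finite quasigroup, let · be a binary operation on Q making (Q, ·) a group, and let α, β, γ : Q → Q be bijections with α(x) · β(y) = γ(x * y) for all x, y ∈ Q. Then the conjugate set { γ ∘ d ∘ γ⁻¹ : d ∈ Dis(Q,*) } equals the set of left translations { y ↦ x · y : x ∈ Q } of the group (Q, ·). -/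
/-- If `(Q,*)` is a finite quasigroup isotopic, via bijections `(α, β, γ)`, to a group
structure `(Q, ·)` on the same set, then the conjugate set
`{ γ ∘ d ∘ γ⁻¹ : d ∈ Dis(Q,*) }` is exactly the set of left translations of `(Q, ·)`. -/
theorem stmt11 {Q : Type*} [Fintype Q] [Group Q] (op : Q → Q → Q)
    (hL : ∀ a, Function.Bijective (op a))
    (hR : ∀ a, Function.Bijective (fun x => op x a))
    (α β γ : Q → Q) (hα : Function.Bijective α) (hβ : Function.Bijective β)
    (hγ : Function.Bijective γ)
    (h : ∀ x y : Q, α x * β y = γ (op x y)) :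
    (fun d : Equiv.Perm Q =>
        Equiv.ofBijective γ hγ * d * (Equiv.ofBijective γ hγ)⁻¹) ''
        (dis op hL : Set (Equiv.Perm Q)) =
      Set.range (fun x : Q => Equiv.mulLeft x) := by
  set g : Equiv.Perm Q := Equiv.ofBijective γ hγ with hg
  set b : Equiv.Perm Q := Equiv.ofBijective β hβ with hb
  have key : ∀ x, leftTrans op hL x = g⁻¹ * (MulAction.toPermHom Q Q (α x)) * b := by
    intro x
    rw [mul_assoc, eq_inv_mul_iff_mul_eq]
    ext y
    exact (h x y).symm
  have gen : ∀ x y, g * (leftTrans op hL x * (leftTrans op hL y)⁻¹) * g⁻¹ =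
      MulAction.toPermHom Q Q (α x * (α y)⁻¹) := by
    intro x y
    rw [key, key, map_mul, map_inv]
    group
  have e : (fun x : Q => Equiv.mulLeft x) = MulAction.toPermHom Q Q := by
    funext x
    ext y
    rfl
  rw [e]
  apply Set.Subset.antisymm
  · rintro _ ⟨d, hd, rfl⟩
    have hle : dis op hL ≤
        (MulAction.toPermHom Q Q).range.comap (MulAut.conj g).toMonoidHom := by
      unfold dis
      rw [Subgroup.closure_le]
      rintro _ ⟨x, y, rfl⟩
      exact ⟨_, (gen x y).symm⟩
    exact hle hd
  · rintro _ ⟨x, rfl⟩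
    obtain ⟨u, hu⟩ := hα.2 x
    obtain ⟨v, hv⟩ := hα.2 1
    refine ⟨_, Subgroup.subset_closure ⟨u, v, rfl⟩, ?_⟩
    have := gen u v
    rw [hu, hv, inv_one, mul_one] at this
    exact this
end

section
/- Let (G, +) be a finite abelian group, let φ₁, ψ₁, φ₂, ψ₂ be automorphisms of (G, +), and let c₁, c₂ ∈ G. Define operations x *₁ y = φ₁(x) + ψ₁(y) + c₁ and x *₂ y = φ₂(x) + ψ₂(y) + c₂ on G. Then there exists a bijection γ : G → G with γ(x *₁ y) = γ(x) *₂ γ(y) for all x, y ∈ G if and only if there exist an automorphism γ of (G, +) and an element u in the image of the endomorphism x ↦ x − φ₁(x) − ψ₁(x) such that φ₂ = γ ∘ φ₁ ∘ γ⁻¹, ψ₂ = γ ∘ ψ₁ ∘ γ⁻¹, and c₂ = γ(c₁ + u). -/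
/-- Isomorphism criterion for central quasigroups (Stanovský–Vojtěchovský): the central
quasigroups `Q(G, +, φ₁, ψ₁, c₁)` and `Q(G, +, φ₂, ψ₂, c₂)` are isomorphic if and only if
there are an automorphism `γ` of `(G, +)` and `u ∈ Im(1 - φ₁ - ψ₁)` with
`φ₂ = γ ∘ φ₁ ∘ γ⁻¹`, `ψ₂ = γ ∘ ψ₁ ∘ γ⁻¹` and `c₂ = γ (c₁ + u)`. -/
theorem stmt14 {G : Type*} [AddCommGroup G] [Fintype G]
    (φ₁ ψ₁ φ₂ ψ₂ : G ≃+ G) (c₁ c₂ : G) :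
    (∃ γ : G → G, Function.Bijective γ ∧
        ∀ x y : G, γ (φ₁ x + ψ₁ y + c₁) = φ₂ (γ x) + ψ₂ (γ y) + c₂) ↔
      (∃ γ : G ≃+ G, ∃ u ∈ Set.range (fun x : G => x - φ₁ x - ψ₁ x),
        (∀ x : G, φ₂ x = γ (φ₁ (γ.symm x))) ∧
        (∀ x : G, ψ₂ x = γ (ψ₁ (γ.symm x))) ∧
        c₂ = γ (c₁ + u)) := by
  constructor
  · rintro ⟨f, hf, h⟩
    have hk : ∀ a b : G, f (a + b + c₁) = φ₂ (f (φ₁.symm a)) + ψ₂ (f (ψ₁.symm b)) + c₂ := by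
      intro a b
      simpa using h (φ₁.symm a) (ψ₁.symm b)
    have hk2 : ∀ a b : G, f (a + b + c₁) + f c₁ = f (a + c₁) + f (b + c₁) := by
      intro a b
      have h1 := hk a b
      have h2 := hk a 0
      have h3 := hk 0 b
      have h4 := hk 0 0
      simp only [add_zero, zero_add] at h2 h3 h4
      rw [h1, h2, h3, h4]
      abel
    have hadd : ∀ a b : G, f (a + b) + f 0 = f a + f b := by
      intro a b
      have h1 := hk2 (a - c₁) (b - c₁)
      have h2 := hk2 (a + b - c₁) (-c₁)
      have e : a + b - c₁ + -c₁ + c₁ = a - c₁ + (b - c₁) + c₁ := by abel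
      rw [e, h1] at h2
      simpa using h2.symm
    let g : G →+ G := AddMonoidHom.mk' (fun x => f x - f 0) (by
      intro a b
      have := hadd a b
      rw [eq_sub_of_add_eq this]
      abel)
    have hg : ∀ x, f x = g x + f 0 := by
      intro x
      simp [g]
    have hgb : Function.Bijective g := by
      have : (g : G → G) = (Equiv.subRight (f 0)) ∘ f := by
        funext x
        simp [g]
      rw [this]
      exact (Equiv.bijective _).comp hf
    have h' : ∀ x y : G, g (φ₁ x) + g (ψ₁ y) + g c₁ + f 0
        = φ₂ (g x) + φ₂ (f 0) + (ψ₂ (g y) + ψ₂ (f 0)) + c₂ := by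
      intro x y
      have := h x y
      rw [hg (φ₁ x + ψ₁ y + c₁), hg x, hg y] at this
      simpa only [map_add] using this
    have h0 : g c₁ + f 0 = φ₂ (f 0) + ψ₂ (f 0) + c₂ := by simpa using h' 0 0
    have hφ : ∀ x, g (φ₁ x) = φ₂ (g x) := by
      intro x
      have h1 := h' x 0
      simp only [map_zero, add_zero, zero_add] at h1
      rw [add_assoc, h0] at h1
      apply add_right_cancel (b := φ₂ (f 0) + ψ₂ (f 0) + c₂)
      rw [h1]
      abel
    have hψ : ∀ x, g (ψ₁ x) = ψ₂ (g x) := by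
      intro x
      have h1 := h' 0 x
      simp only [map_zero, add_zero, zero_add] at h1
      rw [add_assoc, h0] at h1
      apply add_right_cancel (b := φ₂ (f 0) + ψ₂ (f 0) + c₂)
      rw [h1]
      abel
    obtain ⟨t, ht⟩ := hgb.2 (f 0)
    have hs : ∀ x, g ((AddEquiv.ofBijective g hgb).symm x) = x :=
      fun x => (AddEquiv.ofBijective g hgb).apply_symm_apply x
    refine ⟨AddEquiv.ofBijective g hgb, _, ⟨t, rfl⟩, ?_, ?_, ?_⟩
    · intro x
      rw [AddEquiv.ofBijective_apply, hφ, hs]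
    · intro x
      rw [AddEquiv.ofBijective_apply, hψ, hs]
    · rw [AddEquiv.ofBijective_apply]
      simp only [map_add, map_sub, hφ, hψ, ht]
      rw [← sub_eq_of_eq_add' h0]
      abel
  · rintro ⟨γ, u, ⟨t, rfl⟩, hφ, hψ, rfl⟩
    refine ⟨fun x => γ (x + t), γ.bijective.comp (Equiv.addRight t).bijective, ?_⟩
    intro x y
    simp only [hφ, hψ, AddEquiv.symm_apply_apply, ← map_add]
    congr 1
    simp only [map_add]
    abel
end

section
/- Let p be a prime and let G be a finite abelian p-group (written additively), and let x ∈ G. Then there exists a subgroup H of G such that G is the internal direct sum of H and the cyclic subgroup generated by x (i.e., H ∩ ⟨x⟩ = 0 and H + ⟨x⟩ = G) if and only if there is no y ∈ G such that the order of x + p•y is strictly less than the order of x. -/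
theorem stmt15_forward {p : ℕ} (hp : p.Prime) {G : Type*} [AddCommGroup G] [Fintype G]
    (hG : ∃ n : ℕ, Nat.card G = p ^ n) (x : G) (H : AddSubgroup G)
    (h1 : H ⊓ AddSubgroup.zmultiples x = ⊥) (h2 : H ⊔ AddSubgroup.zmultiples x = ⊤) (y : G) :
    addOrderOf x ≤ addOrderOf (x + p • y) := by
  obtain ⟨n, hn⟩ := hG
  have hy : y ∈ H ⊔ AddSubgroup.zmultiples x := by rw [h2]; trivial
  obtain ⟨h, hh, z, hz, rfl⟩ := AddSubgroup.mem_sup.1 hy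
  obtain ⟨c, rfl⟩ := AddSubgroup.mem_zmultiples_iff.1 hz
  set k := addOrderOf (x + p • (h + c • x)) with hk
  have hk0 : 0 < k := addOrderOf_pos _
  have hkz : k • (x + p • (h + c • x)) = 0 := addOrderOf_nsmul_eq_zero _
  have e : ((k : ℤ) * (1 + p * c)) • x = -((k * p) • h) := by
    rw [eq_neg_iff_add_eq_zero, ← hkz]
    module
  have hm : ((k : ℤ) * (1 + p * c)) • x ∈ H ⊓ AddSubgroup.zmultiples x :=
    ⟨by rw [e]; exact H.neg_mem (H.nsmul_mem hh _), AddSubgroup.zsmul_mem_zmultiples _ _⟩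
  rw [h1, AddSubgroup.mem_bot] at hm
  have hd := addOrderOf_dvd_iff_zsmul_eq_zero.2 hm
  have hxp : addOrderOf x ∣ p ^ n := hn ▸ addOrderOf_dvd_natCard x
  have hc : IsCoprime ((p : ℤ) ^ n) (1 + p * c) := by
    apply IsCoprime.pow_left
    exact ⟨-c, 1, by ring⟩
  have hc' : IsCoprime (addOrderOf x : ℤ) (1 + p * c) :=
    hc.of_isCoprime_of_dvd_left (by exact_mod_cast hxp)
  have := hc'.dvd_of_dvd_mul_right hd
  exact Nat.le_of_dvd hk0 (by exact_mod_cast this)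

theorem stmt15_backward {p : ℕ} (hp : p.Prime) {G : Type*} [AddCommGroup G] [Fintype G]
    (hG : ∃ n : ℕ, Nat.card G = p ^ n) (x : G)
    (hx : ∀ y : G, addOrderOf x ≤ addOrderOf (x + p • y)) :
    ∃ H : AddSubgroup G,
        H ⊓ AddSubgroup.zmultiples x = ⊥ ∧ H ⊔ AddSubgroup.zmultiples x = ⊤ := by
  obtain ⟨n, hn⟩ := hG
  have hxp : addOrderOf x ∣ p ^ n := hn ▸ addOrderOf_dvd_natCard x
  obtain ⟨m, -, hm⟩ := (Nat.dvd_prime_pow hp).1 hxp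
  have hpZ : Prime (p : ℤ) := Nat.prime_iff_prime_int.1 hp
  have hmx : ((p : ℤ) ^ m) • x = 0 := by
    have := addOrderOf_nsmul_eq_zero x
    rw [hm] at this
    exact_mod_cast this
  -- the key consequence of the hypothesis
  have key : ∀ (j : ℕ), j + 1 = m → ∀ y : G, ((p : ℤ) ^ j) • (x + (p : ℤ) • y) ≠ 0 := by
    intro j hj y h0
    have h3 : (p ^ j) • (x + p • y) = 0 := by exact_mod_cast h0
    have h4 := Nat.le_of_dvd (pow_pos hp.pos _) (addOrderOf_dvd_of_nsmul_eq_zero h3)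
    have h5 := (hx y).trans h4
    rw [hm, ← hj] at h5
    exact absurd h5 (not_le.2 (Nat.pow_lt_pow_right hp.one_lt (Nat.lt_succ_self j)))
  have bez : ∀ c : ℤ, ¬ (p : ℤ) ∣ c → ∃ u v : ℤ, u * c + v * p = 1 := by
    intro c hc
    have := (hpZ.coprime_iff_not_dvd.2 hc).symm
    exact this
  let P : AddSubgroup G := (zsmulAddGroupHom ((p : ℤ) ^ m)).range
  have hP : P ⊓ AddSubgroup.zmultiples x = ⊥ := by
    rw [eq_bot_iff]
    rintro z ⟨⟨w, hw⟩, hz⟩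
    obtain ⟨b, rfl⟩ := AddSubgroup.mem_zmultiples_iff.1 hz
    have hw' : ((p : ℤ) ^ m) • w = b • x := hw
    have hd : ∀ k, k ≤ m → (p : ℤ) ^ k ∣ b := by
      intro k
      induction k with
      | zero => intro _; simp
      | succ k ih =>
        intro hk
        obtain ⟨c, rfl⟩ := ih (by omega)
        by_cases hc : (p : ℤ) ∣ c
        · rw [pow_succ]; exact mul_dvd_mul_left _ hc
        · exfalso
          obtain ⟨u, v, huv⟩ := bez c hc
          obtain ⟨i, rfl⟩ : ∃ i, m = k + i + 1 := ⟨m - k - 1, by omega⟩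
          refine key (k + i) rfl (-((u * p ^ i) • w)) ?_
          have e1 : ((p : ℤ) ^ (k + i)) • x =
              (u * p ^ i) • ((((p : ℤ) ^ k * c)) • x) + v • (((p : ℤ) ^ (k + i + 1)) • x) := by
            rw [smul_smul, smul_smul, ← add_smul]
            congr 1
            linear_combination -((p : ℤ) ^ (k + i)) * huv
          rw [smul_add, e1, hmx, ← hw']
          module
    obtain ⟨c, rfl⟩ := hd m le_rfl
    change _ = _
    rw [mul_comm, mul_smul, hmx, smul_zero]
  obtain ⟨H, hPH, hH⟩ := Set.Finite.exists_le_maximal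
    (Set.toFinite {K : AddSubgroup G | P ≤ K ∧ K ⊓ AddSubgroup.zmultiples x = ⊥})
    (show P ∈ _ from ⟨le_rfl, hP⟩)
  have hHx := hH.prop.2
  refine ⟨H, hHx, ?_⟩
  by_contra hne
  obtain ⟨g0, hg0⟩ : ∃ g, g ∉ H ⊔ AddSubgroup.zmultiples x := by
    by_contra! hcon
    exact hne ((AddSubgroup.eq_top_iff' _).2 hcon)
  obtain ⟨g, hg, hpg⟩ : ∃ g, g ∉ H ⊔ AddSubgroup.zmultiples x ∧
      (p : ℤ) • g ∈ H ⊔ AddSubgroup.zmultiples x := by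
    by_contra! hcon
    have : ∀ j : ℕ, ((p : ℤ) ^ j) • g0 ∉ H ⊔ AddSubgroup.zmultiples x := by
      intro j
      induction j with
      | zero => simpa using hg0
      | succ j ih => rw [pow_succ', mul_smul]; exact hcon _ ih
    apply this n
    have h0 : (p ^ n) • g0 = 0 := by rw [← hn]; exact card_nsmul_eq_zero'
    have h0' : ((p : ℤ) ^ n) • g0 = 0 := by exact_mod_cast h0
    rw [h0']; exact zero_mem _
  obtain ⟨h, hh, z, hz, hsum⟩ := AddSubgroup.mem_sup.1 hpg
  obtain ⟨a, rfl⟩ := AddSubgroup.mem_zmultiples_iff.1 hz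
  have hxK : ∀ c : ℤ, c • x ∈ H ⊔ AddSubgroup.zmultiples x := fun c =>
    AddSubgroup.mem_sup_right (AddSubgroup.zsmul_mem_zmultiples _ _)
  have hpa : ∃ a' : ℤ, ((p : ℤ) * a') • x = a • x := by
    rcases m with _ | j
    · have : x = 0 := by simpa using hmx
      exact ⟨0, by simp [this]⟩
    · have h6 : ((p : ℤ) ^ j * a) • x = 0 := by
        have : ((p : ℤ) ^ j * a) • x ∈ H ⊓ AddSubgroup.zmultiples x := by
          refine ⟨?_, AddSubgroup.zsmul_mem_zmultiples _ _⟩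
          have e : ((p : ℤ) ^ j * a) • x = ((p : ℤ) ^ (j + 1)) • g - ((p : ℤ) ^ j) • h := by
            rw [pow_succ, mul_smul, mul_smul, ← hsum]
            module
          rw [e]
          exact H.sub_mem (hPH ⟨g, rfl⟩) (H.zsmul_mem hh _)
        rwa [hHx, AddSubgroup.mem_bot] at this
      have h7 := addOrderOf_dvd_iff_zsmul_eq_zero.2 h6
      rw [hm, Nat.cast_pow, pow_succ] at h7
      obtain ⟨a', rfl⟩ := (mul_dvd_mul_iff_left (pow_ne_zero j hpZ.ne_zero)).1 h7
      exact ⟨a', rfl⟩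
  obtain ⟨a', ha'⟩ := hpa
  set g' := g - a' • x with hg'
  have hpg' : (p : ℤ) • g' ∈ H := by
    have : (p : ℤ) • g' = h := by
      rw [hg', smul_sub, ← hsum, smul_smul, ha']; abel
    rwa [this]
  have hg'K : g' ∉ H ⊔ AddSubgroup.zmultiples x := by
    intro hc
    apply hg
    have := add_mem hc (hxK a')
    rwa [hg', sub_add_cancel] at this
  have hbig : H ⊔ AddSubgroup.zmultiples g' ∈
      {K : AddSubgroup G | P ≤ K ∧ K ⊓ AddSubgroup.zmultiples x = ⊥} := by
    refine ⟨hPH.trans le_sup_left, ?_⟩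
    rw [eq_bot_iff]
    rintro z ⟨hz1, hz2⟩
    obtain ⟨h', hh', w, hw, rfl⟩ := AddSubgroup.mem_sup.1 hz1
    obtain ⟨c, rfl⟩ := AddSubgroup.mem_zmultiples_iff.1 hw
    by_cases hc : (p : ℤ) ∣ c
    · obtain ⟨d, rfl⟩ := hc
      have : h' + ((p : ℤ) * d) • g' ∈ H ⊓ AddSubgroup.zmultiples x := by
        refine ⟨H.add_mem hh' ?_, hz2⟩
        rw [mul_comm, mul_smul]
        exact H.zsmul_mem hpg' _
      rwa [hHx] at this
    · exfalso
      obtain ⟨u, v, huv⟩ := bez c hc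
      apply hg'K
      have e : g' = u • ((h' + c • g') - h') + v • ((p : ℤ) • g') := by
        rw [add_sub_cancel_left, smul_smul, smul_smul, ← add_smul, huv, one_smul]
      rw [e]
      exact add_mem (zsmul_mem (sub_mem (AddSubgroup.mem_sup_right hz2)
        (AddSubgroup.mem_sup_left hh')) _) (zsmul_mem (AddSubgroup.mem_sup_left hpg') _)
  have hle := hH.le_of_ge hbig le_sup_left
  exact hg'K (AddSubgroup.mem_sup_left
    (hle (AddSubgroup.mem_sup_right (AddSubgroup.mem_zmultiples g'))))

/-- In a finite abelian `p`-group `G`, an element `x` splits from `G` (i.e. `G` is the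
internal direct sum of some subgroup `H` and `⟨x⟩`) if and only if there is no `y ∈ G`
with `|x + p • y| < |x|`. -/
theorem stmt15 {p : ℕ} (hp : p.Prime) {G : Type*} [AddCommGroup G] [Fintype G]
    (hG : ∃ n : ℕ, Nat.card G = p ^ n) (x : G) :
    (∃ H : AddSubgroup G,
        H ⊓ AddSubgroup.zmultiples x = ⊥ ∧ H ⊔ AddSubgroup.zmultiples x = ⊤) ↔
      ¬ ∃ y : G, addOrderOf (x + p • y) < addOrderOf x := by
  constructor
  · rintro ⟨H, h1, h2⟩ ⟨y, hy⟩
    exact absurd hy (not_lt.2 (stmt15_forward hp hG x H h1 h2 y))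
  · intro h
    push Not at h
    exact stmt15_backward hp hG x h
end

section
/- Let G = G₁ × ⋯ × G_k be the direct product of finite groups G₁, …, G_k, with projections π_i : G → G_i, and let g ∈ G. If the conjugacy class C_g of g is irreducible, then there exists exactly one index i ∈ {1,…,k} such that π_i(g) ∉ Z(G_i). -/
open scoped Pointwise

/-- The conjugacy class of `g` in a group. -/
def conjClass {G : Type*} [Group G] (g : G) : Set G := { h | IsConj g h }

/-- A conjugacy class `C_g` is reducible if either `g` is central, or there are
non-central `a, b` whose conjugacy classes commute elementwise, with
`C_g = C_a · C_b` and `|C_g| = |C_a| · |C_b|`. -/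
def ConjClassReducible {G : Type*} [Group G] (g : G) : Prop :=
  g ∈ Subgroup.center G ∨
    ∃ a b : G, a ∉ Subgroup.center G ∧ b ∉ Subgroup.center G ∧
      (∀ x ∈ conjClass a, ∀ y ∈ conjClass b, Commute x y) ∧
      conjClass g = conjClass a * conjClass b ∧
      Nat.card (conjClass g) = Nat.card (conjClass a) * Nat.card (conjClass b)

/-- In a direct product `G = G₁ × ⋯ × G_k` of finite groups, if the conjugacy class of
`g` is irreducible then there is exactly one index `i` with `π_i(g) ∉ Z(G_i)`. -/
theorem stmt17 {k : ℕ} (G : Fin k → Type*) [∀ i, Group (G i)] [∀ i, Fintype (G i)]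
    (g : (i : Fin k) → G i) (hirr : ¬ ConjClassReducible g) :
    ∃! i : Fin k, g i ∉ Subgroup.center (G i) := by
  have hc : ∀ h : (i : Fin k) → G i,
      h ∈ Subgroup.center ((i : Fin k) → G i) ↔ ∀ i, h i ∈ Subgroup.center (G i) := by
    intro h
    simp only [Subgroup.mem_center_iff]
    constructor
    · intro H i x
      have := congrFun (H (Function.update 1 i x)) i
      simpa using this
    · intro H x
      funext i
      exact H i (x i)
  have hne : ∃ i, g i ∉ Subgroup.center (G i) := by
    by_contra hcon
    push Not at hcon
    exact hirr (Or.inl ((hc g).2 hcon))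
  obtain ⟨i, hi⟩ := hne
  refine ⟨i, hi, ?_⟩
  intro j hj
  by_contra hji
  apply hirr
  set a : (i : Fin k) → G i := Function.update 1 i (g i) with ha
  set b : (i : Fin k) → G i := Function.update g i 1 with hb
  have hai : a i = g i := by simp [ha]
  have hal : ∀ l, l ≠ i → a l = 1 := by
    intro l hl
    simp [ha, hl]
  have hbi : b i = 1 := by simp [hb]
  have hbl : ∀ l, l ≠ i → b l = g l := by
    intro l hl
    simp [hb, hl]
  have hA : ∀ x ∈ conjClass a, ∀ l, l ≠ i → x l = 1 := by
    intro x hx l hl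
    obtain ⟨c, rfl⟩ := isConj_iff.1 hx
    simp [hal l hl]
  have hB : ∀ y ∈ conjClass b, y i = 1 := by
    intro y hy
    obtain ⟨c, rfl⟩ := isConj_iff.1 hy
    simp [hbi]
  have hprod : conjClass g = conjClass a * conjClass b := by
    ext z
    rw [Set.mem_mul]
    constructor
    · intro hz
      obtain ⟨c, rfl⟩ := isConj_iff.1 hz
      refine ⟨c * a * c⁻¹, isConj_iff.2 ⟨c, rfl⟩, c * b * c⁻¹, isConj_iff.2 ⟨c, rfl⟩, ?_⟩
      funext l
      by_cases hl : l = i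
      · subst hl
        simp [hai, hbi]
      · simp [hal l hl, hbl l hl]
    · rintro ⟨x, hx, y, hy, rfl⟩
      obtain ⟨p, rfl⟩ := isConj_iff.1 hx
      obtain ⟨q, rfl⟩ := isConj_iff.1 hy
      refine isConj_iff.2 ⟨Function.update q i (p i), ?_⟩
      funext l
      by_cases hl : l = i
      · subst hl
        simp [hai, hbi]
      · simp [hal l hl, hbl l hl, hl]
  refine Or.inr ⟨a, b, ?_, ?_, ?_, hprod, ?_⟩
  · intro h
    have := (hc a).1 h i
    rw [hai] at this
    exact hi this
  · intro h
    have := (hc b).1 h j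
    rw [hbl j hji] at this
    exact hj this
  · intro x hx y hy
    funext l
    by_cases hl : l = i
    · subst hl
      simp [hB y hy]
    · simp [hA x hx l hl]
  · rw [hprod, ← Nat.card_prod]
    symm
    refine Nat.card_congr (Equiv.ofBijective
      (fun p : conjClass a × conjClass b =>
        (⟨p.1.1 * p.2.1, Set.mul_mem_mul p.1.2 p.2.2⟩ :
          (conjClass a * conjClass b : Set ((i : Fin k) → G i)))) ⟨?_, ?_⟩)
    · rintro ⟨⟨x, hx⟩, ⟨y, hy⟩⟩ ⟨⟨x', hx'⟩, ⟨y', hy'⟩⟩ h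
      have h1 : x * y = x' * y' := congrArg Subtype.val h
      have h2 : x = x' := by
        funext l
        by_cases hl : l = i
        · subst hl
          simpa [hB y hy, hB y' hy'] using congrFun h1 l
        · rw [hA x hx l hl, hA x' hx' l hl]
      subst h2
      have h3 := mul_left_cancel h1
      subst h3
      rfl
    · rintro ⟨z, hz⟩
      obtain ⟨x, hx, y, hy, rfl⟩ := Set.mem_mul.1 hz
      exact ⟨(⟨x, hx⟩, ⟨y, hy⟩), rfl⟩
end
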